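/- arXiv:1201.3702 — 4 statements merged into one kernel-verified Lean document; each statement's English description precedes it below -/
import Mathlib

section
/- Consider the two-stage procedure: accept H_{0τ} if F_τ ≤ ℓ_τ (use I_τ); otherwise, accept H_{0ξ} if F_ξ ≤ ℓ_ξ (use I_ξ); otherwise use I. Then the coverage probability CP(β,σ) = P_{β,σ}(θ ∈ CI) of the resulting confidence interval CI depends, for a fixed design matrix X and contrast vector a, only on the vector (β_{k+1}/σ, …, β_{2k}/σ). That is, if β, β' ∈ ℝ^{2k} and σ, σ' > 0 satisfy β_{k+j}/σ = β'_{k+j}/σ' for all j = 1, …, k, then CP(β,σ) = CP(β',σ'). -/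
open Matrix MeasureTheory ProbabilityTheory

/-- The coverage probability `P_{β,σ}(θ ∈ CI)` of the confidence interval resulting from the
two-stage procedure: use `Iτ` if `Fτ ≤ ℓτ`; otherwise use `Iξ` if `Fξ ≤ ℓξ`; otherwise use `I`.
The error vector `ε` has the `N(0, σ²Iₙ)` distribution, `Y = Xβ + ε`. -/
noncomputable def coverageProb (n k : ℕ) (X : Matrix (Fin n) (Fin (2 * k)) ℝ)
    (Cτ : Matrix (Fin (2 * k)) (Fin k) ℝ) (Cξ : Matrix (Fin (2 * k)) (Fin (k - 1)) ℝ)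
    (a : Fin (2 * k) → ℝ) (ℓτ ℓξ t₁ t₂ t₃ : ℝ) (β : Fin (2 * k) → ℝ) (σ : ℝ) : ℝ :=
  ((Measure.pi fun _ : Fin n => gaussianReal 0 ⟨σ ^ 2, sq_nonneg σ⟩)
    {ε : Fin n → ℝ |
      let Y := X.mulVec β + ε
      let βh := ((Xᵀ * X)⁻¹ * Xᵀ).mulVec Y
      let R := fun b : Fin (2 * k) → ℝ => (Y - X.mulVec b) ⬝ᵥ (Y - X.mulVec b)
      let m : ℝ := (n : ℝ) - 2 * k
      let V₂₂ := Cτᵀ * (Xᵀ * X)⁻¹ * Cτ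
      let W₂₂ := Cξᵀ * (Xᵀ * X)⁻¹ * Cξ
      let τh := Cτᵀ.mulVec βh
      let ξh := Cξᵀ.mulVec βh
      let Fτ := (m / k) * (τh ⬝ᵥ V₂₂⁻¹.mulVec τh) / R βh
      let Fξ := (m / ((k : ℝ) - 1)) * (ξh ⬝ᵥ W₂₂⁻¹.mulVec ξh) / R βh
      let Gτ := (1 : Matrix (Fin (2 * k)) (Fin (2 * k)) ℝ) - (Xᵀ * X)⁻¹ * Cτ * V₂₂⁻¹ * Cτᵀ
      let Gξ := (1 : Matrix (Fin (2 * k)) (Fin (2 * k)) ℝ) - (Xᵀ * X)⁻¹ * Cξ * W₂₂⁻¹ * Cξᵀ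
      let v₁₁ := a ⬝ᵥ ((Xᵀ * X)⁻¹).mulVec a
      let v₂₁ := Cτᵀ.mulVec (((Xᵀ * X)⁻¹).mulVec a)
      let w₂₁ := Cξᵀ.mulVec (((Xᵀ * X)⁻¹).mulVec a)
      let vstar := v₁₁ - v₂₁ ⬝ᵥ V₂₂⁻¹.mulVec v₂₁
      let wstar := v₁₁ - w₂₁ ⬝ᵥ W₂₂⁻¹.mulVec w₂₁
      let θ := a ⬝ᵥ β
      (Fτ ≤ ℓτ ∧
        θ ∈ Set.Icc
          (a ⬝ᵥ Gτ.mulVec βh - t₁ * Real.sqrt (R (Gτ.mulVec βh) / (m + k)) * Real.sqrt vstar)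
          (a ⬝ᵥ Gτ.mulVec βh + t₁ * Real.sqrt (R (Gτ.mulVec βh) / (m + k)) * Real.sqrt vstar)) ∨
      (ℓτ < Fτ ∧ Fξ ≤ ℓξ ∧
        θ ∈ Set.Icc
          (a ⬝ᵥ Gξ.mulVec βh
            - t₂ * Real.sqrt (R (Gξ.mulVec βh) / (m + k - 1)) * Real.sqrt wstar)
          (a ⬝ᵥ Gξ.mulVec βh
            + t₂ * Real.sqrt (R (Gξ.mulVec βh) / (m + k - 1)) * Real.sqrt wstar)) ∨
      (ℓτ < Fτ ∧ ℓξ < Fξ ∧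
        θ ∈ Set.Icc
          (a ⬝ᵥ βh - t₃ * Real.sqrt (R βh / m) * Real.sqrt v₁₁)
          (a ⬝ᵥ βh + t₃ * Real.sqrt (R βh / m) * Real.sqrt v₁₁))}).toReal

lemma pi_gaussianReal_map_smul {ι : Type*} [Fintype ι] {v v' : NNReal} {c : ℝ}
    (h : (v' : ℝ) = c ^ 2 * v) :
    (Measure.pi fun _ : ι => gaussianReal 0 v).map (fun x => c • x)
      = Measure.pi fun _ : ι => gaussianReal 0 v' := by
  have h1 : (gaussianReal 0 v).map (fun x => c * x) = gaussianReal 0 v' := by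
    rw [gaussianReal_map_const_mul, mul_zero]
    congr 1
    ext
    exact h.symm
  have h2 := Measure.pi_map_pi (ι := ι) (X := fun _ => ℝ) (Y := fun _ => ℝ)
    (μ := fun _ => gaussianReal 0 v) (f := fun _ x => c * x)
    (hμ := fun _ => by rw [h1]; infer_instance)
    (fun _ => by fun_prop)
  simp only [h1] at h2
  exact h2

lemma leastSquares_affine {ι κ : Type*} [Fintype ι] [Fintype κ] [DecidableEq κ]
    (X : Matrix ι κ ℝ) (hX : IsUnit (Xᵀ * X).det) (c : ℝ) (δ : κ → ℝ) (Y : ι → ℝ) :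
    ((Xᵀ * X)⁻¹ * Xᵀ).mulVec (c • Y + X.mulVec δ)
      = c • ((Xᵀ * X)⁻¹ * Xᵀ).mulVec Y + δ := by
  rw [mulVec_add, mulVec_smul, mulVec_mulVec, Matrix.mul_assoc _ Xᵀ X, nonsing_inv_mul _ hX,
    one_mulVec]

lemma residual_affine {ι κ : Type*} [Fintype ι] [Fintype κ]
    (X : Matrix ι κ ℝ) (c : ℝ) (b δ : κ → ℝ) (Y : ι → ℝ) :
    (c • Y + X.mulVec δ - X.mulVec (c • b + δ)) ⬝ᵥ (c • Y + X.mulVec δ - X.mulVec (c • b + δ))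
      = c ^ 2 * ((Y - X.mulVec b) ⬝ᵥ (Y - X.mulVec b)) := by
  have : c • Y + X.mulVec δ - X.mulVec (c • b + δ) = c • (Y - X.mulVec b) := by
    rw [mulVec_add, mulVec_smul, smul_sub]
    abel
  rw [this, smul_dotProduct, dotProduct_smul, smul_eq_mul, smul_eq_mul]
  ring

lemma one_sub_mul_mulVec_affine {κ ι : Type*} [Fintype κ] [DecidableEq κ] [Fintype ι]
    (A : Matrix κ ι ℝ) (C : Matrix κ ι ℝ) {δ : κ → ℝ} (hδ : Cᵀ.mulVec δ = 0) (c : ℝ)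
    (b : κ → ℝ) :
    (1 - A * Cᵀ).mulVec (c • b + δ) = c • (1 - A * Cᵀ).mulVec b + δ := by
  rw [mulVec_add, mulVec_smul, sub_mulVec _ _ δ, ← mulVec_mulVec, hδ, mulVec_zero, one_mulVec,
    sub_zero]

lemma mulVec_affine {κ ι : Type*} [Fintype κ]
    (C : Matrix ι κ ℝ) {δ : κ → ℝ} (hδ : C.mulVec δ = 0) (c : ℝ) (b : κ → ℝ) :
    C.mulVec (c • b + δ) = c • C.mulVec b := by
  rw [mulVec_add, mulVec_smul, hδ, add_zero]

lemma fStatistic_smul {ι : Type*} [Fintype ι] (M : Matrix ι ι ℝ) {c : ℝ} (hc : c ≠ 0)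
    (r s : ℝ) (v : ι → ℝ) :
    r * ((c • v) ⬝ᵥ M.mulVec (c • v)) / (c ^ 2 * s) = r * (v ⬝ᵥ M.mulVec v) / s := by
  rw [mulVec_smul, smul_dotProduct, dotProduct_smul, smul_eq_mul, smul_eq_mul,
    ← mul_div_mul_left _ s (pow_ne_zero 2 hc)]
  congr 1
  ring

lemma mem_Icc_interval_affine {κ : Type*} [Fintype κ] (a b β δ : κ → ℝ) {c : ℝ} (hc : 0 < c)
    (t s q r : ℝ) :
    (a ⬝ᵥ (c • β + δ) ∈ Set.Icc
        (a ⬝ᵥ (c • b + δ) - t * Real.sqrt (c ^ 2 * s / q) * r)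
        (a ⬝ᵥ (c • b + δ) + t * Real.sqrt (c ^ 2 * s / q) * r))
      ↔ a ⬝ᵥ β ∈ Set.Icc (a ⬝ᵥ b - t * Real.sqrt (s / q) * r)
        (a ⬝ᵥ b + t * Real.sqrt (s / q) * r) := by
  rw [mul_div_assoc, Real.sqrt_mul (sq_nonneg c), Real.sqrt_sq hc.le]
  simp only [dotProduct_add, dotProduct_smul, smul_eq_mul, Set.mem_Icc]
  generalize Real.sqrt (s / q) = u
  have h1 : t * (c * u) * r = c * (t * u * r) := by ring
  rw [h1]
  constructor
  · rintro ⟨h2, h3⟩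
    exact ⟨le_of_mul_le_mul_left (by linarith) hc, le_of_mul_le_mul_left (by linarith) hc⟩
  · rintro ⟨h2, h3⟩
    have := mul_le_mul_of_nonneg_left h2 hc.le
    have := mul_le_mul_of_nonneg_left h3 hc.le
    constructor <;> linarith

/-- The coverage probability of the confidence interval constructed after
the two-stage procedure depends on `(β, σ)` only through `(β_{k+1}/σ, …, β_{2k}/σ)`. -/
theorem coverageProb_depends_only_on_scaled_slopes
    (n k : ℕ) (hk : 1 ≤ k) (hn : 2 * k + 1 ≤ n)
    (X : Matrix (Fin n) (Fin (2 * k)) ℝ) (hX : IsUnit (Xᵀ * X).det)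
    (Cτ : Matrix (Fin (2 * k)) (Fin k) ℝ)
    (hCτ : ∀ (b : Fin (2 * k) → ℝ) (j : Fin k),
      Cτᵀ.mulVec b j = b ⟨k + (j : ℕ), by omega⟩)
    (Cξ : Matrix (Fin (2 * k)) (Fin (k - 1)) ℝ)
    (hCξ : ∀ (b : Fin (2 * k) → ℝ) (j : Fin (k - 1)),
      Cξᵀ.mulVec b j = b ⟨k, by omega⟩ - b ⟨k + 1 + (j : ℕ), by omega⟩)
    (hV : IsUnit (Cτᵀ * (Xᵀ * X)⁻¹ * Cτ).det)
    (hW : IsUnit (Cξᵀ * (Xᵀ * X)⁻¹ * Cξ).det)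
    (a : Fin (2 * k) → ℝ) (ℓτ ℓξ t₁ t₂ t₃ : ℝ)
    (hℓτ : 0 < ℓτ) (hℓξ : 0 < ℓξ) (ht₁ : 0 < t₁) (ht₂ : 0 < t₂) (ht₃ : 0 < t₃)
    (β β' : Fin (2 * k) → ℝ) (σ σ' : ℝ) (hσ : 0 < σ) (hσ' : 0 < σ')
    (h : ∀ j : Fin k, β ⟨k + (j : ℕ), by omega⟩ / σ = β' ⟨k + (j : ℕ), by omega⟩ / σ') :
    coverageProb n k X Cτ Cξ a ℓτ ℓξ t₁ t₂ t₃ β σ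
      = coverageProb n k X Cτ Cξ a ℓτ ℓξ t₁ t₂ t₃ β' σ' := by
  obtain ⟨c, hc⟩ : ∃ c, c = σ' / σ := ⟨_, rfl⟩
  have hc0 : 0 < c := hc ▸ div_pos hσ' hσ
  obtain ⟨δ, rfl⟩ : ∃ δ, β' = c • β + δ := ⟨β' - c • β, by abel⟩
  have hδ (j : Fin k) : δ ⟨k + (j : ℕ), by omega⟩ = 0 := by
    have hj := h j
    simp only [Pi.add_apply, Pi.smul_apply, smul_eq_mul, hc] at hj
    field_simp at hj
    exact (mul_eq_zero.mp (left_eq_add.mp hj)).resolve_left hσ.ne'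
  have hδτ : Cτᵀ.mulVec δ = 0 := by
    ext j
    rw [hCτ, hδ, Pi.zero_apply]
  have hδξ : Cξᵀ.mulVec δ = 0 := by
    ext j
    have h0 := hδ ⟨0, by omega⟩
    have h1 := hδ ⟨1 + j, by omega⟩
    simp only [add_zero, ← add_assoc] at h0 h1
    rw [hCξ, h0, h1, sub_zero, Pi.zero_apply]
  unfold coverageProb
  have hmap : (Measure.pi fun _ : Fin n => gaussianReal 0 ⟨σ' ^ 2, sq_nonneg σ'⟩)
      = (Measure.pi fun _ : Fin n => gaussianReal 0 ⟨σ ^ 2, sq_nonneg σ⟩).map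
        (fun x => c • x) := by
    refine (pi_gaussianReal_map_smul ?_).symm
    change σ' ^ 2 = c ^ 2 * σ ^ 2
    rw [hc]
    field_simp
  rw [hmap]
  have he : MeasurableEmbedding fun x : Fin n → ℝ => c • x :=
    (MeasurableEquiv.smul₀ c hc0.ne').measurableEmbedding
  rw [he.map_apply]
  congr 2
  ext ε
  have hY : X.mulVec (c • β + δ) + c • ε = c • (X.mulVec β + ε) + X.mulVec δ := by
    rw [mulVec_add, mulVec_smul, smul_add]
    abel
  simp only [Set.preimage_ofPred_eq, Set.mem_ofPred_eq, hY, leastSquares_affine X hX,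
    residual_affine, mulVec_affine _ hδτ, mulVec_affine _ hδξ,
    one_sub_mul_mulVec_affine _ _ hδτ, one_sub_mul_mulVec_affine _ _ hδξ,
    fStatistic_smul _ hc0.ne', mem_Icc_interval_affine _ _ _ _ hc0]
end

section
/- The coverage probability CP(β,σ) = P_{β,σ}(θ ∈ CI) of the confidence interval CI resulting from the two-stage procedure is a function of γ = β/σ only; that is, for all β ∈ ℝ^{2k} and σ, σ' > 0, CP(β, σ) = CP((σ'/σ)·β, σ'). In particular CP(β,σ) = CP(β/σ, 1). -/
open Matrix MeasureTheory ProbabilityTheory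

/-- Scaling by `c` maps the law `N(0, v Iₙ)` to `N(0, c²v Iₙ)`. -/
lemma map_smul_pi_gaussianReal (n : ℕ) (c : ℝ) (v : NNReal) :
    (Measure.pi fun _ : Fin n => gaussianReal 0 v).map (fun ε => c • ε)
      = Measure.pi fun _ : Fin n => gaussianReal 0 (.mk (c ^ 2) (sq_nonneg c) * v) := by
  have hg : (gaussianReal 0 v).map (fun x => c * x)
      = gaussianReal 0 (.mk (c ^ 2) (sq_nonneg c) * v) := by
    rw [gaussianReal_map_const_mul, mul_zero]
  have hpi := Measure.pi_map_pi (μ := fun _ : Fin n => gaussianReal 0 v)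
    (f := fun _ x => c * x) (hμ := fun _ => by rw [hg]; infer_instance)
    (fun _ => (measurable_const_mul c).aemeasurable)
  simp only [hg] at hpi
  exact hpi

lemma sqrt_mul_mul_div {c : ℝ} (hc : 0 ≤ c) (r d : ℝ) :
    Real.sqrt (c * (c * r) / d) = c * Real.sqrt (r / d) := by
  rw [← mul_assoc, mul_div_assoc, Real.sqrt_mul (mul_self_nonneg c), Real.sqrt_mul_self hc]

lemma mul_mul_mul_div_mul_mul {c : ℝ} (hc : c ≠ 0) (s q r : ℝ) :
    s * (c * (c * q)) / (c * (c * r)) = s * q / r := by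
  rw [show s * (c * (c * q)) = c * (c * (s * q)) by ring, mul_div_mul_left _ _ hc,
    mul_div_mul_left _ _ hc]

lemma mul_mem_Icc_sub_add_iff {c : ℝ} (hc : 0 < c) (x p t s v : ℝ) :
    c * x ∈ Set.Icc (c * p - t * (c * s) * v) (c * p + t * (c * s) * v)
      ↔ x ∈ Set.Icc (p - t * s * v) (p + t * s * v) := by
  rw [show c * p - t * (c * s) * v = c * (p - t * s * v) by ring,
    show c * p + t * (c * s) * v = c * (p + t * s * v) by ring]
  simp only [Set.mem_Icc, mul_le_mul_iff_right₀ hc]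

lemma coverageProb_smul (n k : ℕ) (X : Matrix (Fin n) (Fin (2 * k)) ℝ)
    (Cτ : Matrix (Fin (2 * k)) (Fin k) ℝ) (Cξ : Matrix (Fin (2 * k)) (Fin (k - 1)) ℝ)
    (a : Fin (2 * k) → ℝ) (ℓτ ℓξ t₁ t₂ t₃ : ℝ) (β : Fin (2 * k) → ℝ) (σ : ℝ)
    {c : ℝ} (hc : 0 < c) :
    coverageProb n k X Cτ Cξ a ℓτ ℓξ t₁ t₂ t₃ (c • β) (c * σ)
      = coverageProb n k X Cτ Cξ a ℓτ ℓξ t₁ t₂ t₃ β σ := by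
  have hvar : NNReal.mk ((c * σ) ^ 2) (sq_nonneg (c * σ))
      = .mk (c ^ 2) (sq_nonneg c) * .mk (σ ^ 2) (sq_nonneg σ) :=
    NNReal.eq (mul_pow c σ 2)
  have hmap := map_smul_pi_gaussianReal n c (.mk (σ ^ 2) (sq_nonneg σ))
  rw [← hvar] at hmap
  unfold coverageProb
  erw [← hmap, (measurableEmbedding_const_smul₀ hc.ne').map_apply]
  congr 2
  ext ε
  simp only [Set.mem_preimage, Set.mem_ofPred_eq, mulVec_smul, ← smul_add, ← smul_sub,
    smul_dotProduct, dotProduct_smul, smul_eq_mul, sqrt_mul_mul_div hc.le,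
    mul_mul_mul_div_mul_mul hc.ne', mul_mem_Icc_sub_add_iff hc]

/-- The coverage probability of the confidence interval constructed after the
two-stage procedure is a function of `γ = β/σ` only: `CP(β, σ) = CP((σ'/σ)·β, σ')` for all
`σ, σ' > 0`; in particular `CP(β, σ) = CP(β/σ, 1)`. -/
theorem coverageProb_scale_invariant
    (n k : ℕ) (hk : 1 ≤ k) (hn : 2 * k + 1 ≤ n)
    (X : Matrix (Fin n) (Fin (2 * k)) ℝ) (hX : IsUnit (Xᵀ * X).det)
    (Cτ : Matrix (Fin (2 * k)) (Fin k) ℝ)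
    (hCτ : ∀ (b : Fin (2 * k) → ℝ) (j : Fin k),
      Cτᵀ.mulVec b j = b ⟨k + (j : ℕ), by omega⟩)
    (Cξ : Matrix (Fin (2 * k)) (Fin (k - 1)) ℝ)
    (hCξ : ∀ (b : Fin (2 * k) → ℝ) (j : Fin (k - 1)),
      Cξᵀ.mulVec b j = b ⟨k, by omega⟩ - b ⟨k + 1 + (j : ℕ), by omega⟩)
    (hV : IsUnit (Cτᵀ * (Xᵀ * X)⁻¹ * Cτ).det)
    (hW : IsUnit (Cξᵀ * (Xᵀ * X)⁻¹ * Cξ).det)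
    (a : Fin (2 * k) → ℝ) (ℓτ ℓξ t₁ t₂ t₃ : ℝ)
    (hℓτ : 0 < ℓτ) (hℓξ : 0 < ℓξ) (ht₁ : 0 < t₁) (ht₂ : 0 < t₂) (ht₃ : 0 < t₃)
    (β : Fin (2 * k) → ℝ) (σ σ' : ℝ) (hσ : 0 < σ) (hσ' : 0 < σ') :
    coverageProb n k X Cτ Cξ a ℓτ ℓξ t₁ t₂ t₃ β σ
        = coverageProb n k X Cτ Cξ a ℓτ ℓξ t₁ t₂ t₃ ((σ' / σ) • β) σ' ∧
    coverageProb n k X Cτ Cξ a ℓτ ℓξ t₁ t₂ t₃ β σ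
        = coverageProb n k X Cτ Cξ a ℓτ ℓξ t₁ t₂ t₃ (fun i => β i / σ) 1 := by
  have key := fun τ (hτ : 0 < τ) =>
    coverageProb_smul n k X Cτ Cξ a ℓτ ℓξ t₁ t₂ t₃ β σ (div_pos hτ hσ)
  simp only [div_mul_cancel₀ _ hσ.ne'] at key
  refine ⟨(key σ' hσ').symm, ?_⟩
  rw [← key 1 one_pos]
  congr 1
  ext i
  simp [div_eq_inv_mul]
end

section
/- The scaled variance of aᵀG_ξβ̂ equals w*: for any contrast vector a ∈ ℝ^{2k}, aᵀ G_ξ (XᵀX)⁻¹ G_ξᵀ a = v₁₁ − w₂₁ᵀ W₂₂⁻¹ w₂₁ = w*, where v₁₁ = aᵀ(XᵀX)⁻¹a and w₂₁ = C_ξᵀ(XᵀX)⁻¹a. -/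
open Matrix

/-- If `V` is symmetric and `W = CᵀVC` is invertible, then `G = 1 - V C W⁻¹ Cᵀ` satisfies
`G V Gᵀ = V - V C W⁻¹ Cᵀ V`. -/
theorem Matrix.one_sub_mul_mul_transpose_of_isSymm {m p R : Type*} [Fintype m] [DecidableEq m]
    [Fintype p] [DecidableEq p] [CommRing R] {V : Matrix m m R} (hV : V.IsSymm)
    (C : Matrix m p R) (hW : IsUnit (Cᵀ * V * C).det) :
    (1 - V * C * (Cᵀ * V * C)⁻¹ * Cᵀ) * V * (1 - V * C * (Cᵀ * V * C)⁻¹ * Cᵀ)ᵀ =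
      V - V * C * (Cᵀ * V * C)⁻¹ * Cᵀ * V := by
  have hGVC : (1 - V * C * (Cᵀ * V * C)⁻¹ * Cᵀ) * V * C = 0 := by
    have h : V * C * (Cᵀ * V * C)⁻¹ * Cᵀ * V * C =
        V * C * ((Cᵀ * V * C)⁻¹ * (Cᵀ * V * C)) := by
      simp only [Matrix.mul_assoc]
    rw [Matrix.sub_mul, Matrix.sub_mul, Matrix.one_mul, h, nonsing_inv_mul _ hW,
      Matrix.mul_one, sub_self]
  have hGT : (1 - V * C * (Cᵀ * V * C)⁻¹ * Cᵀ)ᵀ = 1 - C * ((Cᵀ * V * C)⁻¹ᵀ * (Cᵀ * V)) := by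
    simp only [transpose_sub, transpose_one, transpose_mul, transpose_transpose, hV.eq]
  rw [hGT, Matrix.mul_sub, ← Matrix.mul_assoc _ C, hGVC, Matrix.zero_mul, sub_zero,
    Matrix.mul_one, Matrix.sub_mul, Matrix.one_mul]

/-- The scaled variance of `aᵀG_ξβ̂` equals `w*`:
`aᵀ G_ξ (XᵀX)⁻¹ G_ξᵀ a = v₁₁ − w₂₁ᵀ W₂₂⁻¹ w₂₁ = w*`. -/
theorem scaled_variance_Gxi
    (n k : ℕ) (hk : 1 ≤ k)
    (X : Matrix (Fin n) (Fin (2 * k)) ℝ) (hX : IsUnit (Xᵀ * X).det)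
    (Cξ : Matrix (Fin (2 * k)) (Fin (k - 1)) ℝ)
    (hCξ : ∀ (b : Fin (2 * k) → ℝ) (j : Fin (k - 1)),
      Cξᵀ.mulVec b j = b ⟨k, by omega⟩ - b ⟨k + 1 + (j : ℕ), by omega⟩)
    (hW : IsUnit (Cξᵀ * (Xᵀ * X)⁻¹ * Cξ).det)
    (a : Fin (2 * k) → ℝ) :
    letI W₂₂ := Cξᵀ * (Xᵀ * X)⁻¹ * Cξ
    letI Gξ := (1 : Matrix (Fin (2 * k)) (Fin (2 * k)) ℝ) - (Xᵀ * X)⁻¹ * Cξ * W₂₂⁻¹ * Cξᵀ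
    letI v₁₁ := a ⬝ᵥ ((Xᵀ * X)⁻¹).mulVec a
    letI w₂₁ := Cξᵀ.mulVec (((Xᵀ * X)⁻¹).mulVec a)
    a ⬝ᵥ (Gξ * (Xᵀ * X)⁻¹ * Gξᵀ).mulVec a = v₁₁ - w₂₁ ⬝ᵥ W₂₂⁻¹.mulVec w₂₁ := by
  have hV : ((Xᵀ * X)⁻¹).IsSymm := by
    rw [IsSymm, transpose_nonsing_inv, transpose_mul, transpose_transpose]
  rw [one_sub_mul_mul_transpose_of_isSymm hV Cξ hW, sub_mulVec, dotProduct_sub]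
  congr 1
  rw [mulVec_mulVec, mulVec_mulVec, ← vecMul_transpose (Cξᵀ * _) a, ← dotProduct_mulVec,
    transpose_mul, transpose_transpose, hV.eq, mulVec_mulVec]
  simp only [Matrix.mul_assoc]
end

section
/- Under the model Y ~ N(Xβ, σ²Iₙ), the (k+1)-dimensional random vector (aᵀG_ξβ̂, C_τᵀβ̂) has a multivariate normal distribution with mean vector (aᵀβ − w₂₁ᵀW₂₂⁻¹ξ, τ), where ξ = C_ξᵀβ and τ = C_τᵀβ, and covariance matrix σ² · [[w*, s₂₁ᵀ], [s₂₁, V₂₂]], where s₂₁ = v₂₁ − C_τᵀ(XᵀX)⁻¹C_ξW₂₂⁻¹w₂₁ and w* = v₁₁ − w₂₁ᵀW₂₂⁻¹w₂₁. -/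
open Matrix MeasureTheory ProbabilityTheory

/-- A linear functional of a vector of i.i.d. centered Gaussians is a centered Gaussian. -/
lemma map_dotProduct_pi_gaussianReal {ι : Type*} [Fintype ι] (v : NNReal) (l : ι → ℝ) :
    Measure.map (fun x => l ⬝ᵥ x) (Measure.pi fun _ : ι => gaussianReal 0 v)
      = gaussianReal 0 (v * (l ⬝ᵥ l)).toNNReal := by
  classical
  have hg : ∀ i, HasGaussianLaw (fun x : ι → ℝ => l i * x i)
      (Measure.pi fun _ : ι => gaussianReal 0 v) := fun i => by
    have h : HasGaussianLaw (fun x : ι → ℝ => x i)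
        (Measure.pi fun _ : ι => gaussianReal 0 v) :=
      HasLaw.hasGaussianLaw (μ := gaussianReal 0 v)
        (measurePreserving_eval (fun _ : ι => gaussianReal 0 v) i).hasLaw
    exact h.fun_smul (l i)
  have hind : iIndepFun (fun i (x : ι → ℝ) => l i * x i)
      (Measure.pi fun _ : ι => gaussianReal 0 v) :=
    iIndepFun_pi (X := fun i (t : ℝ) => l i * t) fun i => by fun_prop
  have hsum := hind.hasGaussianLaw_fun_sum hg
  have hmem : ∀ i, MemLp (fun t : ℝ => l i * t) 2 (gaussianReal 0 v) := fun i =>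
    (memLp_id_gaussianReal 2).const_mul (l i)
  have hmean : ∫ x, ∑ i, l i * x i ∂(Measure.pi fun _ : ι => gaussianReal 0 v) = 0 := by
    rw [integral_finsetSum _ fun i _ => (hg i).integrable]
    refine Finset.sum_eq_zero fun i _ => ?_
    rw [integral_const_mul, integral_comp_eval (μ := fun _ : ι => gaussianReal 0 v)
      (f := fun t : ℝ => t) aestronglyMeasurable_id, integral_id_gaussianReal, mul_zero]
  have hvar : Var[fun x => ∑ i, l i * x i; Measure.pi fun _ : ι => gaussianReal 0 v]
      = v * (l ⬝ᵥ l) := by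
    have h := variance_sum_pi (μ := fun _ : ι => gaussianReal 0 v) hmem
    have he : (∑ i, fun x : ι → ℝ => l i * x i) = fun x => ∑ i, l i * x i := by
      ext x; simp
    rw [he] at h
    rw [h, dotProduct, Finset.mul_sum]
    refine Finset.sum_congr rfl fun i _ => ?_
    rw [variance_const_mul, variance_fun_id_gaussianReal]
    ring
  change Measure.map (fun x : ι → ℝ => ∑ i, l i * x i) _ = _
  rw [hsum.map_eq_gaussianReal, hmean, hvar]

/-- A linear functional of the least squares estimator `(XᵀX)⁻¹Xᵀ(Xβ + ε)` with i.i.d. centered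
Gaussian noise `ε` is Gaussian, with mean `uᵀβ` and variance `v · uᵀ(XᵀX)⁻¹u`. -/
lemma map_dotProduct_leastSquares {m p : Type*} [Fintype m] [Fintype p] [DecidableEq p]
    (X : Matrix m p ℝ) (hX : IsUnit (Xᵀ * X).det) (v : NNReal) (β u : p → ℝ) :
    Measure.map (fun ε => u ⬝ᵥ ((Xᵀ * X)⁻¹ * Xᵀ) *ᵥ (X *ᵥ β + ε))
        (Measure.pi fun _ : m => gaussianReal 0 v)
      = gaussianReal (u ⬝ᵥ β) (v * (u ⬝ᵥ (Xᵀ * X)⁻¹ *ᵥ u)).toNNReal := by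
  have hsymm : ((Xᵀ * X)⁻¹)ᵀ = (Xᵀ * X)⁻¹ := by
    rw [transpose_nonsing_inv, transpose_mul, transpose_transpose]
  have hlin : (fun ε => u ⬝ᵥ ((Xᵀ * X)⁻¹ * Xᵀ) *ᵥ (X *ᵥ β + ε))
      = (fun t => u ⬝ᵥ β + t) ∘ fun ε => (u ᵥ* ((Xᵀ * X)⁻¹ * Xᵀ)) ⬝ᵥ ε := by
    ext ε
    rw [mulVec_add, mulVec_mulVec, Matrix.mul_assoc, nonsing_inv_mul _ hX, one_mulVec,
      dotProduct_add, dotProduct_mulVec]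
    rfl
  have hnorm : (u ᵥ* ((Xᵀ * X)⁻¹ * Xᵀ)) ⬝ᵥ (u ᵥ* ((Xᵀ * X)⁻¹ * Xᵀ))
      = u ⬝ᵥ (Xᵀ * X)⁻¹ *ᵥ u := by
    rw [← dotProduct_mulVec, ← mulVec_transpose, mulVec_mulVec, transpose_mul,
      transpose_transpose, hsymm, Matrix.mul_assoc, ← Matrix.mul_assoc Xᵀ,
      mul_nonsing_inv _ hX, Matrix.mul_one]
  rw [hlin, ← Measure.map_map (by fun_prop) (by simp only [dotProduct]; fun_prop),
    map_dotProduct_pi_gaussianReal, gaussianReal_map_const_add, zero_add, hnorm]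

/-- Quadratic form of a symmetric block matrix with a scalar leading block. -/
lemma dotProduct_mulVec_cons_cons {k : ℕ} (w r : ℝ) (s t : Fin k → ℝ)
    (V : Matrix (Fin k) (Fin k) ℝ) :
    (Fin.cons r t : Fin (k + 1) → ℝ) ⬝ᵥ
        (Matrix.of (Fin.cons (Fin.cons w s) fun i => Fin.cons (s i) (V i)) :
          Matrix (Fin (k + 1)) (Fin (k + 1)) ℝ) *ᵥ (Fin.cons r t)
      = r ^ 2 * w + 2 * r * (t ⬝ᵥ s) + t ⬝ᵥ V *ᵥ t := by
  simp only [dotProduct, mulVec, Fin.sum_univ_succ, Fin.cons_zero, Fin.cons_succ, of_apply,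
    mul_add, Finset.sum_add_distrib, Finset.mul_sum]
  have h₁ : ∑ i, r * (s i * t i) = ∑ i, r * (t i * s i) :=
    Finset.sum_congr rfl fun i _ => by ring
  have h₂ : ∑ i, t i * (s i * r) = ∑ i, r * (t i * s i) :=
    Finset.sum_congr rfl fun i _ => by ring
  have h₃ : ∑ i, 2 * r * (t i * s i) = 2 * ∑ i, r * (t i * s i) := by
    rw [Finset.mul_sum]; exact Finset.sum_congr rfl fun i _ => by ring
  rw [h₁, h₂, h₃]
  ring

lemma mulVec_dotProduct_eq_transpose {p q : Type*} [Fintype p] [Fintype q]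
    (E : Matrix p q ℝ) (y : q → ℝ) (z : p → ℝ) :
    (E *ᵥ y) ⬝ᵥ z = y ⬝ᵥ Eᵀ *ᵥ z := by
  rw [dotProduct_mulVec, vecMul_transpose]

/-- Subtracting from `a` the vector `C W⁻¹ Cᵀ M a`, where `W = Cᵀ M C`, and adding `D t`:
the resulting quadratic form in the symmetric matrix `M`. -/
lemma dotProduct_mulVec_projected {p q r : Type*} [Fintype p] [Fintype q] [DecidableEq q]
    [Fintype r] (M : Matrix p p ℝ) (hM : Mᵀ = M) (C : Matrix p q ℝ) (D : Matrix p r ℝ)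
    (hW : IsUnit (Cᵀ * M * C).det) (a : p → ℝ) (x : ℝ) (t : r → ℝ) :
    (x • (a - C *ᵥ (Cᵀ * M * C)⁻¹ *ᵥ Cᵀ *ᵥ M *ᵥ a) + D *ᵥ t) ⬝ᵥ
        M *ᵥ (x • (a - C *ᵥ (Cᵀ * M * C)⁻¹ *ᵥ Cᵀ *ᵥ M *ᵥ a) + D *ᵥ t)
      = x ^ 2 * (a ⬝ᵥ M *ᵥ a
          - (Cᵀ *ᵥ M *ᵥ a) ⬝ᵥ (Cᵀ * M * C)⁻¹ *ᵥ Cᵀ *ᵥ M *ᵥ a)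
        + 2 * x * (t ⬝ᵥ (Dᵀ *ᵥ M *ᵥ a
          - (Dᵀ * M * C * (Cᵀ * M * C)⁻¹) *ᵥ Cᵀ *ᵥ M *ᵥ a))
        + t ⬝ᵥ (Dᵀ * M * D) *ᵥ t := by
  have hcomm : ∀ y z, y ⬝ᵥ M *ᵥ z = z ⬝ᵥ M *ᵥ y := fun y z => by
    rw [dotProduct_mulVec, ← mulVec_transpose, hM, dotProduct_comm]
  have hWw : Cᵀ *ᵥ M *ᵥ C *ᵥ (Cᵀ * M * C)⁻¹ *ᵥ Cᵀ *ᵥ M *ᵥ a = Cᵀ *ᵥ M *ᵥ a := by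
    rw [mulVec_mulVec, mulVec_mulVec, mulVec_mulVec,
      mul_nonsing_inv _ hW, one_mulVec]
  have hDs : (Dᵀ * M * C * (Cᵀ * M * C)⁻¹) *ᵥ Cᵀ *ᵥ M *ᵥ a
      = Dᵀ *ᵥ M *ᵥ C *ᵥ (Cᵀ * M * C)⁻¹ *ᵥ Cᵀ *ᵥ M *ᵥ a := by
    simp only [← mulVec_mulVec]
  have hDD : (Dᵀ * M * D) *ᵥ t = Dᵀ *ᵥ M *ᵥ D *ᵥ t := by
    simp only [← mulVec_mulVec]
  rw [hDs, hDD, dotProduct_sub, ← mulVec_dotProduct_eq_transpose D, ← mulVec_dotProduct_eq_transpose D, ← mulVec_dotProduct_eq_transpose D]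
  set w := Cᵀ *ᵥ M *ᵥ a with hw
  set y := (Cᵀ * M * C)⁻¹ *ᵥ w
  have hpa : (C *ᵥ y) ⬝ᵥ M *ᵥ a = w ⬝ᵥ y := by
    rw [mulVec_dotProduct_eq_transpose, ← hw, dotProduct_comm]
  have hpp : (C *ᵥ y) ⬝ᵥ M *ᵥ (C *ᵥ y) = w ⬝ᵥ y := by
    rw [mulVec_dotProduct_eq_transpose, hWw, dotProduct_comm]
  simp only [mulVec_add, mulVec_sub, mulVec_smul, dotProduct_add, add_dotProduct,
    sub_dotProduct, dotProduct_sub, smul_dotProduct, dotProduct_smul, smul_eq_mul]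
  rw [hcomm a (C *ᵥ y), hcomm a (D *ᵥ t), hcomm (C *ᵥ y) (D *ᵥ t), hpa, hpp]
  ring

/-- Under the model `Y ~ N(Xβ, σ²Iₙ)`, the `(k+1)`-dimensional random vector
`(aᵀG_ξβ̂, C_τᵀβ̂)` has a multivariate normal distribution with mean vector
`(aᵀβ − w₂₁ᵀW₂₂⁻¹ξ, τ)` and covariance matrix `σ²·[[w*, s₂₁ᵀ], [s₂₁, V₂₂]]`.
(Multivariate normality with the given mean and covariance is expressed by the standard
characterization: for every `c ∈ ℝ^{k+1}`, the law of `cᵀZ` is the one-dimensional Gaussian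
with mean `cᵀμ` and variance `cᵀ(σ²Σ)c`.) -/
theorem aGxi_tau_multivariate_normal
    (n k : ℕ) (hk : 1 ≤ k) (hn : 2 * k + 1 ≤ n)
    (X : Matrix (Fin n) (Fin (2 * k)) ℝ) (hX : IsUnit (Xᵀ * X).det)
    (Cτ : Matrix (Fin (2 * k)) (Fin k) ℝ)
    (hCτ : ∀ (b : Fin (2 * k) → ℝ) (j : Fin k),
      Cτᵀ.mulVec b j = b ⟨k + (j : ℕ), by omega⟩)
    (Cξ : Matrix (Fin (2 * k)) (Fin (k - 1)) ℝ)
    (hCξ : ∀ (b : Fin (2 * k) → ℝ) (j : Fin (k - 1)),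
      Cξᵀ.mulVec b j = b ⟨k, by omega⟩ - b ⟨k + 1 + (j : ℕ), by omega⟩)
    (hV : IsUnit (Cτᵀ * (Xᵀ * X)⁻¹ * Cτ).det)
    (hW : IsUnit (Cξᵀ * (Xᵀ * X)⁻¹ * Cξ).det)
    (a : Fin (2 * k) → ℝ) (β : Fin (2 * k) → ℝ) (σ : ℝ) (hσ : 0 < σ) :
    letI P : Measure (Fin n → ℝ) := Measure.pi fun _ => gaussianReal 0 ⟨σ ^ 2, sq_nonneg σ⟩
    letI V₂₂ := Cτᵀ * (Xᵀ * X)⁻¹ * Cτ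
    letI W₂₂ := Cξᵀ * (Xᵀ * X)⁻¹ * Cξ
    letI Gξ := (1 : Matrix (Fin (2 * k)) (Fin (2 * k)) ℝ) - (Xᵀ * X)⁻¹ * Cξ * W₂₂⁻¹ * Cξᵀ
    letI v₁₁ := a ⬝ᵥ ((Xᵀ * X)⁻¹).mulVec a
    letI v₂₁ := Cτᵀ.mulVec (((Xᵀ * X)⁻¹).mulVec a)
    letI w₂₁ := Cξᵀ.mulVec (((Xᵀ * X)⁻¹).mulVec a)
    letI wstar := v₁₁ - w₂₁ ⬝ᵥ W₂₂⁻¹.mulVec w₂₁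
    letI s₂₁ := v₂₁ - (Cτᵀ * (Xᵀ * X)⁻¹ * Cξ * W₂₂⁻¹).mulVec w₂₁
    letI βh : (Fin n → ℝ) → (Fin (2 * k) → ℝ) :=
      fun ε => ((Xᵀ * X)⁻¹ * Xᵀ).mulVec (X.mulVec β + ε)
    -- the random vector `Z = (aᵀG_ξβ̂, C_τᵀβ̂) ∈ ℝ^{k+1}`
    letI Z : (Fin n → ℝ) → (Fin (k + 1) → ℝ) :=
      fun ε => Fin.cons (a ⬝ᵥ Gξ.mulVec (βh ε)) (Cτᵀ.mulVec (βh ε))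
    -- its mean vector `(aᵀβ − w₂₁ᵀW₂₂⁻¹ξ, τ)` where `ξ = C_ξᵀβ`, `τ = C_τᵀβ`
    letI μvec : Fin (k + 1) → ℝ :=
      Fin.cons (a ⬝ᵥ β - w₂₁ ⬝ᵥ W₂₂⁻¹.mulVec (Cξᵀ.mulVec β)) (Cτᵀ.mulVec β)
    -- the covariance matrix `σ²·[[w*, s₂₁ᵀ], [s₂₁, V₂₂]]`
    letI covMat : Matrix (Fin (k + 1)) (Fin (k + 1)) ℝ :=
      σ ^ 2 • Matrix.of (Fin.cons (Fin.cons wstar s₂₁) fun i => Fin.cons (s₂₁ i) (V₂₂ i))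
    ∀ c : Fin (k + 1) → ℝ,
      Measure.map (fun ε => c ⬝ᵥ Z ε) P
        = gaussianReal (c ⬝ᵥ μvec) (c ⬝ᵥ covMat.mulVec c).toNNReal := by
  intro c
  obtain ⟨x, t, rfl⟩ : ∃ (x : ℝ) (t : Fin k → ℝ), c = Fin.cons x t :=
    ⟨c 0, Fin.tail c, (Fin.cons_self_tail c).symm⟩
  have hcons : ∀ (r : ℝ) (s : Fin k → ℝ),
      (Fin.cons x t : Fin (k + 1) → ℝ) ⬝ᵥ (Fin.cons r s : Fin (k + 1) → ℝ)
        = x * r + t ⬝ᵥ s := fun r s => by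
    simp [dotProduct, Fin.sum_univ_succ]
  have hM : ((Xᵀ * X)⁻¹)ᵀ = (Xᵀ * X)⁻¹ := by
    rw [transpose_nonsing_inv, transpose_mul, transpose_transpose]
  have hlin := map_dotProduct_leastSquares X hX ⟨σ ^ 2, sq_nonneg σ⟩ β
    (x • (a - Cξ *ᵥ (Cξᵀ * (Xᵀ * X)⁻¹ * Cξ)⁻¹ *ᵥ Cξᵀ *ᵥ (Xᵀ * X)⁻¹ *ᵥ a) + Cτ *ᵥ t)
  rw [dotProduct_mulVec_projected _ hM Cξ Cτ hW] at hlin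
  generalize (Xᵀ * X)⁻¹ = M at hM hlin ⊢
  have hWt : ((Cξᵀ * M * Cξ)⁻¹)ᵀ = (Cξᵀ * M * Cξ)⁻¹ := by
    simp only [transpose_nonsing_inv, transpose_mul, transpose_transpose, hM, Matrix.mul_assoc]
  have hq : ∀ b : Fin (2 * k) → ℝ,
      (Cξ *ᵥ (Cξᵀ * M * Cξ)⁻¹ *ᵥ Cξᵀ *ᵥ M *ᵥ a) ⬝ᵥ b
        = (Cξᵀ *ᵥ M *ᵥ a) ⬝ᵥ (Cξᵀ * M * Cξ)⁻¹ *ᵥ Cξᵀ *ᵥ b := fun b => by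
    rw [dotProduct_mulVec, dotProduct_mulVec, vecMul_transpose, ← mulVec_transpose, hWt]
  have hG : ∀ b : Fin (2 * k) → ℝ,
      a ⬝ᵥ (1 - M * Cξ * (Cξᵀ * M * Cξ)⁻¹ * Cξᵀ) *ᵥ b
        = a ⬝ᵥ b - (Cξᵀ *ᵥ M *ᵥ a) ⬝ᵥ (Cξᵀ * M * Cξ)⁻¹ *ᵥ Cξᵀ *ᵥ b := fun b => by
    rw [sub_mulVec, one_mulVec, dotProduct_sub]
    simp only [← mulVec_mulVec]
    rw [dotProduct_mulVec a M, ← mulVec_transpose, hM, dotProduct_mulVec _ Cξ,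
      ← mulVec_transpose]
  have hu : ∀ b : Fin (2 * k) → ℝ,
      (x • (a - Cξ *ᵥ (Cξᵀ * M * Cξ)⁻¹ *ᵥ Cξᵀ *ᵥ M *ᵥ a) + Cτ *ᵥ t) ⬝ᵥ b
        = x * (a ⬝ᵥ b - (Cξᵀ *ᵥ M *ᵥ a) ⬝ᵥ (Cξᵀ * M * Cξ)⁻¹ *ᵥ Cξᵀ *ᵥ b)
          + t ⬝ᵥ Cτᵀ *ᵥ b := fun b => by
    rw [add_dotProduct, smul_dotProduct, sub_dotProduct, hq, mulVec_dotProduct_eq_transpose Cτ, smul_eq_mul]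
  simp only [hu] at hlin
  simp only [hcons, hG, smul_mulVec, dotProduct_smul, dotProduct_mulVec_cons_cons, smul_eq_mul]
  exact hlin
end
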